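/- Let H be a complex Hilbert space, A : H → H a bounded selfadjoint operator with ⟨Au,u⟩ ≥ c‖u‖² (c > 0), let l₁,…,lₙ be positive integers and 0 ≤ φ < π. For each multi-index α = (α₁,…,αₙ) with αₖ ≤ 2lₖ and ν_α := Σₖ αₖ/(2lₖ) < 1, let μ_α ∈ (0, 1 − ν_α) and let A_α : ℝⁿ → L(H) be a function with sup_{x∈ℝⁿ} ‖A_α(x) ∘ A^{−(1−ν_α−μ_α)}‖_{L(H)} ≤ M < ∞. Then there exist λ₀ ≥ 0 and C > 0 such that for every λ ∈ S_φ with |λ| ≥ λ₀, every t ∈ (0,∞)ⁿ and all u, f ∈ S(ℝⁿ; H) satisfying Σₖ (−1)^{lₖ} tₖ ∂ₖ^{2lₖ} u(x) + A(u(x)) + λ u(x) + Σ_{α : ν_α < 1} (∏ₖ tₖ^{αₖ/(2lₖ)}) A_α(x)(D^α u(x)) = f(x) for all x ∈ ℝⁿ, one has Σₖ Σ_{i=0}^{2lₖ} tₖ^{i/(2lₖ)} |λ|^{1−i/(2lₖ)} ‖∂ₖ^{i} u‖_{L²(ℝⁿ;H)} + ‖x ↦ A(u(x))‖_{L²(ℝⁿ;H)}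 ≤ C ‖f‖_{L²(ℝⁿ;H)}. -/

import Mathlib

open MeasureTheory

noncomputable section

/-- The sector `S_φ = {λ ∈ ℂ : |arg λ| ≤ φ} ∪ {0}`. -/
def Sector (φ : ℝ) : Set ℂ := {z | z = 0 ∨ |z.arg| ≤ φ}

/-- Fractional power `A^θ` of a bounded selfadjoint operator via the continuous
functional calculus applied to `s ↦ s ^ θ`. -/
def fracPow {H : Type*} [NormedAddCommGroup H] [InnerProductSpace ℂ H]
    [CompleteSpace H] (A : H →L[ℂ] H) (θ : ℝ) : H →L[ℂ] H :=
  cfc (fun s : ℝ => s ^ θ) A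

/-- `i`-th classical partial derivative in the `k`-th coordinate of a Schwartz function. -/
def pdIter (n : ℕ) {H : Type*} [NormedAddCommGroup H] [NormedSpace ℝ H] (k : Fin n)
    (i : ℕ) (u : SchwartzMap (Fin n → ℝ) H) : SchwartzMap (Fin n → ℝ) H :=
  (fun v => LineDeriv.lineDerivOpCLM ℝ (SchwartzMap (Fin n → ℝ) H)
    (Pi.single k 1 : Fin n → ℝ) v)^[i] u

/-- The mixed partial derivative `D^α u = ∂₁^{α₁} ⋯ ∂ₙ^{αₙ} u` of a Schwartz function. -/
def Dmix (n : ℕ) {H : Type*} [NormedAddCommGroup H] [NormedSpace ℝ H] (α : Fin n → ℕ)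
    (u : SchwartzMap (Fin n → ℝ) H) : SchwartzMap (Fin n → ℝ) H :=
  (List.finRange n).foldl (fun v k => pdIter n k (α k) v) u

/-- The Bochner `L²(ℝⁿ; H)` norm of a function. -/
def L2N (n : ℕ) {H : Type*} [NormedAddCommGroup H] (f : (Fin n → ℝ) → H) : ℝ :=
  (∫ x, ‖f x‖ ^ 2) ^ ((1 : ℝ) / 2)

/-- The order `ν_α = ∑ k, α k / (2 l k)` of a multi-index `α` with `α k ≤ 2 l k`. -/
def nuOrd (n : ℕ) (l : Fin n → ℕ) (α : ∀ k : Fin n, Fin (2 * l k + 1)) : ℝ :=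
  ∑ k, ((α k : ℕ) : ℝ) / (2 * (l k : ℝ))

open FourierTransform in
/-- The Fourier transform of a Schwartz function on `Fin n → ℝ`, computed on the Euclidean
space with the same coordinates. -/
def piFourier (n : ℕ) (H : Type*) [NormedAddCommGroup H] [InnerProductSpace ℂ H] :
    SchwartzMap (Fin n → ℝ) H →L[ℂ] SchwartzMap (EuclideanSpace ℝ (Fin n)) H :=
  fourierCLM ℂ (SchwartzMap (EuclideanSpace ℝ (Fin n)) H) ∘L
    SchwartzMap.compCLMOfContinuousLinearEquiv ℂ (EuclideanSpace.equiv (Fin n) ℝ)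

section PiFourier

open FourierTransform LineDeriv

variable {n : ℕ} {H : Type*} [NormedAddCommGroup H] [InnerProductSpace ℂ H]

lemma piFourier_eq (u : SchwartzMap (Fin n → ℝ) H) :
    piFourier n H u =
      𝓕 (SchwartzMap.compCLMOfContinuousLinearEquiv ℂ (EuclideanSpace.equiv (Fin n) ℝ) u) :=
  rfl

lemma piFourier_lineDerivOp (k : Fin n) (u : SchwartzMap (Fin n → ℝ) H)
    (ξ : EuclideanSpace ℝ (Fin n)) :
    piFourier n H (∂_{(Pi.single k 1 : Fin n → ℝ)} u) ξ =
      (2 * Real.pi * Complex.I * ξ k) • piFourier n H u ξ := by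
  have h : (Pi.single k 1 : Fin n → ℝ) =
      EuclideanSpace.equiv (Fin n) ℝ (EuclideanSpace.single k 1) := rfl
  have hg : (inner ℝ · (EuclideanSpace.single k (1 : ℝ)) :
      EuclideanSpace ℝ (Fin n) → ℝ).HasTemperateGrowth :=
    ((innerSL ℝ).flip _).hasTemperateGrowth
  rw [piFourier_eq, h, ← SchwartzMap.lineDerivOp_compCLMOfContinuousLinearEquiv,
    SchwartzMap.fourier_lineDerivOp_eq, ← piFourier_eq, smul_apply,
    SchwartzMap.smulLeftCLM_apply_apply hg, mul_smul,
    EuclideanSpace.inner_single_right]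
  simp [mul_smul]

lemma piFourier_pdIter (k : Fin n) (i : ℕ) (u : SchwartzMap (Fin n → ℝ) H)
    (ξ : EuclideanSpace ℝ (Fin n)) :
    piFourier n H (pdIter n k i u) ξ =
      (2 * Real.pi * Complex.I * ξ k) ^ i • piFourier n H u ξ := by
  induction i with
  | zero => simp [pdIter]
  | succ i ih =>
    have h : pdIter n k (i + 1) u = ∂_{(Pi.single k 1 : Fin n → ℝ)} (pdIter n k i u) := by
      simp only [pdIter, Function.iterate_succ_apply', lineDerivOpCLM_apply]
    rw [h, piFourier_lineDerivOp, ih, smul_smul, pow_succ']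

lemma piFourier_Dmix (α : Fin n → ℕ) (u : SchwartzMap (Fin n → ℝ) H)
    (ξ : EuclideanSpace ℝ (Fin n)) :
    piFourier n H (Dmix n α u) ξ =
      (∏ k, (2 * Real.pi * Complex.I * ξ k) ^ α k) • piFourier n H u ξ := by
  have h (L : List (Fin n)) : ∀ v : SchwartzMap (Fin n → ℝ) H,
      piFourier n H (L.foldl (fun v k => pdIter n k (α k) v) v) ξ =
        (L.map fun k => (2 * Real.pi * Complex.I * ξ k) ^ α k).prod • piFourier n H v ξ := by
    induction L with
    | nil => simp
    | cons k L ih =>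
      intro v
      rw [List.foldl_cons, ih, piFourier_pdIter, smul_smul, List.map_cons, List.prod_cons,
        mul_comm]
  rw [Dmix, h, ← List.ofFn_eq_map, List.prod_ofFn]

lemma piFourier_postcompCLM [CompleteSpace H] (T : H →L[ℂ] H) (u : SchwartzMap (Fin n → ℝ) H)
    (ξ : EuclideanSpace ℝ (Fin n)) :
    piFourier n H (u.postcompCLM T) ξ = T (piFourier n H u ξ) := by
  simp only [piFourier_eq, SchwartzMap.fourier_coe, Real.fourier_eq]
  rw [← T.integral_comp_comm]
  · simp [Circle.smul_def]
  · rw [Real.fourierIntegral_convergent_iff]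
    exact SchwartzMap.integrable _

lemma integral_norm_sq_piFourier [CompleteSpace H] (u : SchwartzMap (Fin n → ℝ) H) :
    ∫ ξ, ‖piFourier n H u ξ‖ ^ 2 = ∫ x, ‖u x‖ ^ 2 := by
  rw [piFourier_eq, SchwartzMap.integral_norm_sq_fourier]
  exact (PiLp.volume_preserving_ofLp (Fin n)).integral_comp
    (MeasurableEquiv.toLp 2 (Fin n → ℝ)).symm.measurableEmbedding (fun x => ‖u x‖ ^ 2)

end PiFourier

section L2Norm

variable {n : ℕ} {H : Type*} [NormedAddCommGroup H]

lemma L2N_nonneg (f : (Fin n → ℝ) → H) : 0 ≤ L2N n f := by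
  unfold L2N
  positivity

lemma L2N_eq_sqrt (f : (Fin n → ℝ) → H) : L2N n f = √(∫ x, ‖f x‖ ^ 2) := by
  rw [L2N, Real.sqrt_eq_rpow]

lemma L2N_eq_eLpNorm {f : (Fin n → ℝ) → H} (hf : MemLp f 2) :
    L2N n f = (eLpNorm f 2).toReal := by
  rw [hf.eLpNorm_eq_integral_rpow_norm (by norm_num) (by norm_num), ENNReal.toReal_ofReal]
  · simp [L2N]
  · positivity

lemma L2N_le_sum {ι : Type*} (s : Finset ι) {f : (Fin n → ℝ) → H}
    {v : ι → (Fin n → ℝ) → H} (hf : MemLp f 2) (hv : ∀ j ∈ s, MemLp (v j) 2)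
    (h : ∀ x, ‖f x‖ ≤ ∑ j ∈ s, ‖v j x‖) :
    L2N n f ≤ ∑ j ∈ s, L2N n (v j) := by
  rw [Finset.sum_congr rfl fun j hj => L2N_eq_eLpNorm (hv j hj), L2N_eq_eLpNorm hf,
    ← ENNReal.toReal_sum fun j hj => (hv j hj).eLpNorm_ne_top]
  refine ENNReal.toReal_mono (ENNReal.sum_ne_top.2 fun j hj => (hv j hj).eLpNorm_ne_top) ?_
  have hsum := eLpNorm_sum_le (μ := volume) (p := 2) (s := s) (f := fun j x => ‖v j x‖)
    (fun j hj => (hv j hj).1.norm) one_le_two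
  simp only [eLpNorm_norm] at hsum
  refine le_trans (eLpNorm_mono_real fun x => ?_) hsum
  simpa using h x

lemma L2N_const_smul [NormedSpace ℝ H] (r : ℝ) (f : (Fin n → ℝ) → H) :
    L2N n (fun x => r • f x) = |r| * L2N n f := by
  simp_rw [L2N_eq_sqrt, norm_smul, mul_pow, integral_const_mul, Real.norm_eq_abs]
  rw [Real.sqrt_mul (by positivity), Real.sqrt_sq (abs_nonneg r)]

end L2Norm

lemma L2N_le_of_piFourier_le {n : ℕ} {H : Type*} [NormedAddCommGroup H] [InnerProductSpace ℂ H]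
    [CompleteSpace H] {v g : SchwartzMap (Fin n → ℝ) H} {r K : ℝ} (hr : 0 ≤ r)
    (hK : 0 ≤ K) (h : ∀ ξ, r * ‖piFourier n H v ξ‖ ≤ K * ‖piFourier n H g ξ‖) :
    r * L2N n v ≤ K * L2N n g := by
  have hint (w : SchwartzMap (EuclideanSpace ℝ (Fin n)) H) :
      Integrable (fun ξ => ‖w ξ‖ ^ 2) := by
    simpa using (w.memLp 2).integrable_norm_pow (by norm_num)
  rw [L2N_eq_sqrt, L2N_eq_sqrt, ← integral_norm_sq_piFourier, ← integral_norm_sq_piFourier,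
    ← Real.sqrt_sq hK, ← Real.sqrt_sq hr, ← Real.sqrt_mul (sq_nonneg K),
    ← Real.sqrt_mul (sq_nonneg r), ← integral_const_mul, ← integral_const_mul]
  refine Real.sqrt_le_sqrt
    (integral_mono ((hint _).const_mul _) ((hint _).const_mul _) fun ξ => ?_)
  simp only [← mul_pow]
  exact pow_le_pow_left₀ (by positivity) (h ξ) 2

lemma re_inner_smul_left_real {H : Type*} [NormedAddCommGroup H] [InnerProductSpace ℂ H]
    (a : ℝ) (v w : H) : RCLike.re (inner ℂ (a • v) w : ℂ) = a * RCLike.re (inner ℂ v w : ℂ) := by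
  rw [← Complex.coe_smul, inner_smul_left]
  simp

lemma continuousOn_rpow_spectrum {H : Type*} [NormedAddCommGroup H]
    [InnerProductSpace ℂ H] {A : H →L[ℂ] H} (hpos : ∀ s ∈ spectrum ℝ A, 0 < s) (θ : ℝ) :
    ContinuousOn (fun s : ℝ => s ^ θ) (spectrum ℝ A) := fun s hs =>
  (Real.continuousAt_rpow_const s θ (Or.inl (hpos s hs).ne')).continuousWithinAt

section FracPow

variable {H : Type*} [NormedAddCommGroup H] [InnerProductSpace ℂ H] [CompleteSpace H]
  {A : H →L[ℂ] H}

lemma le_of_mem_spectrum_of_coercive (hA : IsSelfAdjoint A) {c : ℝ}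
    (hcoer : ∀ u : H, c * ‖u‖ ^ 2 ≤ (inner ℂ (A u) u : ℂ).re) {s : ℝ} (hs : s ∈ spectrum ℝ A) :
    c ≤ s := by
  refine (algebraMap_le_iff_le_spectrum (r := c) (a := A) hA).1 ?_ s hs
  rw [ContinuousLinearMap.le_def]
  refine ContinuousLinearMap.isPositive_def'.2
    ⟨hA.sub (IsSelfAdjoint.algebraMap _ (IsSelfAdjoint.all c)), fun u => ?_⟩
  rw [ContinuousLinearMap.reApplyInnerSelf_apply, sub_apply, inner_sub_left, map_sub,
    Algebra.algebraMap_eq_smul_one, smul_apply, one_apply_eq_self, re_inner_smul_left_real,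
    inner_self_eq_norm_sq]
  exact sub_nonneg.2 (hcoer u)

lemma fracPow_neg_comp_fracPow (hA : IsSelfAdjoint A) (hpos : ∀ s ∈ spectrum ℝ A, 0 < s)
    (θ : ℝ) : fracPow A (-θ) ∘L fracPow A θ = 1 := by
  have h := cfc_mul (fun s : ℝ => s ^ (-θ)) (fun s : ℝ => s ^ θ) A
    (continuousOn_rpow_spectrum hpos _) (continuousOn_rpow_spectrum hpos _)
  rw [cfc_congr (g := fun _ => 1), cfc_const_one ℝ A] at h
  · exact h.symm
  · intro s hs
    simp [← Real.rpow_add (hpos s hs)]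

lemma rpow_mul_rpow_sq_le {r s θ : ℝ} (hr : 0 ≤ r) (hs : 0 ≤ s) (h0 : 0 ≤ θ) (h1 : θ ≤ 1) :
    (r ^ (1 - θ)) ^ 2 * (s ^ θ * s ^ θ) ≤ r ^ 2 + s ^ 2 := by
  have h : r ^ (1 - θ) * s ^ θ ≤ max r s := by
    calc r ^ (1 - θ) * s ^ θ ≤ max r s ^ (1 - θ) * max r s ^ θ := by
          gcongr
          · exact le_max_left _ _
          · exact le_max_right _ _
      _ = max r s := by
          rw [← Real.rpow_add' (le_max_of_le_left hr) (by simp)]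
          simp
  calc (r ^ (1 - θ)) ^ 2 * (s ^ θ * s ^ θ) = (r ^ (1 - θ) * s ^ θ) ^ 2 := by ring
    _ ≤ max r s ^ 2 := by gcongr
    _ ≤ r ^ 2 + s ^ 2 := by
        rcases max_cases r s with h | h <;> rw [h.1] <;> nlinarith [sq_nonneg r, sq_nonneg s]

lemma norm_fracPow_sq_le (hA : IsSelfAdjoint A) (hpos : ∀ s ∈ spectrum ℝ A, 0 < s)
    {r θ : ℝ} (hr : 0 ≤ r) (h0 : 0 ≤ θ) (h1 : θ ≤ 1) (w : H) :
    (r ^ (1 - θ) * ‖fracPow A θ w‖) ^ 2 ≤ r ^ 2 * ‖w‖ ^ 2 + ‖A w‖ ^ 2 := by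
  have hcont := continuousOn_rpow_spectrum hpos θ
  have hB : IsSelfAdjoint (fracPow A θ) := cfc_predicate _ A
  have hle : (r ^ (1 - θ)) ^ 2 • (fracPow A θ * fracPow A θ) ≤
      algebraMap ℝ (H →L[ℂ] H) (r ^ 2) + A ^ 2 := by
    have h := cfc_mono (a := A) (f := fun s : ℝ => (r ^ (1 - θ)) ^ 2 * (s ^ θ * s ^ θ))
      (g := fun s => r ^ 2 + s ^ 2)
      (fun s hs => rpow_mul_rpow_sq_le hr (hpos s hs).le h0 h1)
      (continuousOn_const.mul (hcont.mul hcont)) (by fun_prop)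
    rwa [cfc_const_mul _ (fun s : ℝ => s ^ θ * s ^ θ) A (hcont.mul hcont),
      cfc_mul _ _ A hcont hcont, cfc_const_add _ _ A, cfc_pow_id A 2] at h
  have hsq {T : H →L[ℂ] H} (hT : IsSelfAdjoint T) :
      RCLike.re (inner ℂ ((T * T) w) w : ℂ) = ‖T w‖ ^ 2 := by
    have h := ContinuousLinearMap.isSelfAdjoint_iff_isSymmetric.1 hT (T w) w
    simp only [ContinuousLinearMap.coe_coe] at h
    rw [mul_apply_eq_comp, h]
    exact inner_self_eq_norm_sq (𝕜 := ℂ) (T w)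
  have h := ((ContinuousLinearMap.le_def _ _).1 hle).re_inner_nonneg_left w
  rw [sub_apply, inner_sub_left, map_sub, add_apply, inner_add_left, map_add, smul_apply,
    re_inner_smul_left_real, Algebra.algebraMap_eq_smul_one, smul_apply, one_apply_eq_self,
    re_inner_smul_left_real, inner_self_eq_norm_sq, hsq hB, sq A, hsq hA] at h
  rw [mul_pow]
  linarith

end FracPow

lemma exists_neg_mul_norm_le_re {φ : ℝ} (hφ0 : 0 ≤ φ) (hφπ : φ < Real.pi) :
    ∃ κ : ℝ, 0 ≤ κ ∧ κ < 1 ∧ ∀ z ∈ Sector φ, -κ * ‖z‖ ≤ z.re := by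
  refine ⟨max 0 (-Real.cos φ), le_max_left _ _, max_lt one_pos ?_, fun z hz => ?_⟩
  · have := Real.cos_lt_cos_of_nonneg_of_le_pi hφ0 le_rfl hφπ
    rw [Real.cos_pi] at this
    linarith
  · rcases hz with rfl | hz
    · simp
    · have h1 : Real.cos φ ≤ Real.cos z.arg := by
        rw [← Real.cos_abs z.arg]
        exact Real.cos_le_cos_of_nonneg_of_le_pi (abs_nonneg _) hφπ.le hz
      have h2 := Complex.norm_mul_cos_arg z
      nlinarith [norm_nonneg z, le_max_right 0 (-Real.cos φ)]

/-- Uniform resolvent estimate for the operators `p + A + z` with `p ≥ 0` and `z` in a sector. -/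
lemma exists_resolvent_bound {H : Type*} [NormedAddCommGroup H] [InnerProductSpace ℂ H]
    {A : H →L[ℂ] H} (hA : ∀ u : H, 0 ≤ (inner ℂ (A u) u : ℂ).re)
    (hAim : ∀ u : H, (inner ℂ (A u) u : ℂ).im = 0)
    {φ : ℝ} (hφ0 : 0 ≤ φ) (hφπ : φ < Real.pi) :
    ∃ K : ℝ, 0 < K ∧ ∀ z ∈ Sector φ, ∀ p : ℝ, 0 ≤ p → ∀ w : H,
      (p + ‖z‖) ^ 2 * ‖w‖ ^ 2 + ‖A w‖ ^ 2 ≤ (K * ‖(p : ℂ) • w + A w + z • w‖) ^ 2 := by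
  obtain ⟨κ, hκ0, hκ1, hκ⟩ := exists_neg_mul_norm_le_re hφ0 hφπ
  have hκ' : 0 < 1 - κ := sub_pos.2 hκ1
  refine ⟨√(2 / (1 - κ)), by positivity, fun z hz p hp w => ?_⟩
  rw [mul_pow, Real.sq_sqrt (by positivity), div_mul_eq_mul_div, le_div_iff₀ hκ']
  set b := (p : ℂ) • w + A w with hb
  have hbw : (inner ℂ b w : ℂ) = ((p * ‖w‖ ^ 2 + (inner ℂ (A w) w : ℂ).re : ℝ) : ℂ) := by
    apply Complex.ext
    · simp [hb]
    · rw [Complex.ofReal_im, hb, inner_add_left, Complex.add_im, hAim, inner_smul_left,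
        inner_self_eq_norm_sq_to_K]
      simp [← Complex.ofReal_pow]
  have hbw0 : 0 ≤ p * ‖w‖ ^ 2 + (inner ℂ (A w) w : ℂ).re := by
    have := hA w
    positivity
  have hcs : p * ‖w‖ ^ 2 + (inner ℂ (A w) w : ℂ).re ≤ ‖b‖ * ‖w‖ := by
    have h := norm_inner_le_norm (𝕜 := ℂ) b w
    rwa [hbw, Complex.norm_real, Real.norm_of_nonneg hbw0] at h
  have hbsq : p ^ 2 * ‖w‖ ^ 2 + ‖A w‖ ^ 2 ≤ ‖b‖ ^ 2 := by
    rw [hb, norm_add_sq (𝕜 := ℂ), norm_smul, Complex.coe_smul,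
      re_inner_smul_left_real, inner_re_symm]
    have : 0 ≤ p * RCLike.re (inner ℂ (A w) w : ℂ) := mul_nonneg hp (hA w)
    rw [Complex.norm_real, Real.norm_of_nonneg hp]
    linarith
  have hg : ‖b + z • w‖ ^ 2 = ‖b‖ ^ 2 + ‖z‖ ^ 2 * ‖w‖ ^ 2 +
      2 * (z.re * (p * ‖w‖ ^ 2 + (inner ℂ (A w) w : ℂ).re)) := by
    rw [norm_add_sq (𝕜 := ℂ), norm_smul, inner_smul_right, hbw,
      mul_comm z]
    change _ + 2 * (Complex.re _) + _ = _
    rw [Complex.re_ofReal_mul]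
    ring
  set e := p * ‖w‖ ^ 2 + (inner ℂ (A w) w : ℂ).re
  have hre : -(κ * (‖b‖ ^ 2 + ‖z‖ ^ 2 * ‖w‖ ^ 2)) ≤ 2 * (z.re * e) := by
    have h1 : -κ * ‖z‖ * e ≤ z.re * e := mul_le_mul_of_nonneg_right (hκ z hz) hbw0
    have h2 : κ * ‖z‖ * e ≤ κ * ‖z‖ * (‖b‖ * ‖w‖) := by gcongr
    nlinarith [mul_nonneg hκ0 (sq_nonneg (‖b‖ - ‖z‖ * ‖w‖))]
  rw [hg]
  have h3 : (p + ‖z‖) ^ 2 * ‖w‖ ^ 2 ≤ 2 * (p ^ 2 + ‖z‖ ^ 2) * ‖w‖ ^ 2 := by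
    gcongr
    nlinarith [sq_nonneg (p - ‖z‖)]
  have h4 : (p + ‖z‖) ^ 2 * ‖w‖ ^ 2 + ‖A w‖ ^ 2 ≤ 2 * (‖b‖ ^ 2 + ‖z‖ ^ 2 * ‖w‖ ^ 2) := by
    nlinarith [sq_nonneg ‖A w‖]
  nlinarith [mul_le_mul_of_nonneg_left h4 hκ'.le]

lemma rpow_div_mul_abs_pow {t : ℝ} (ht : 0 < t) (y : ℝ) {l : ℕ} (hl : 0 < l) (i : ℕ) :
    t ^ ((i : ℝ) / (2 * l)) * |y| ^ i = (t * |y| ^ (2 * l)) ^ ((i : ℝ) / (2 * l)) := by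
  have hl' : (2 * l : ℝ) ≠ 0 := by positivity
  rw [Real.mul_rpow ht.le (by positivity), ← Real.rpow_natCast |y| (2 * l),
    ← Real.rpow_mul (abs_nonneg y)]
  push_cast
  rw [mul_div_cancel₀ _ hl', Real.rpow_natCast]

lemma norm_two_pi_I_mul (y : ℝ) : ‖2 * Real.pi * Complex.I * (y : ℂ)‖ = |2 * Real.pi * y| := by
  simp [abs_mul]

lemma neg_one_pow_mul_two_pi_I_mul_pow (y : ℝ) (l : ℕ) :
    ((-1 : ℝ) ^ l : ℂ) * (2 * Real.pi * Complex.I * (y : ℂ)) ^ (2 * l) =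
      ((|2 * Real.pi * y| ^ (2 * l) : ℝ) : ℂ) := by
  rw [pow_mul |_|, sq_abs, pow_mul, ← mul_pow]
  push_cast
  congr 1
  linear_combination (-4 * Real.pi ^ 2 * (y : ℂ) ^ 2) * Complex.I_sq

/-- The symbol `∑ k, t k * (2 π |ξ k|) ^ (2 * l k)` of the principal part. -/
def principalSymbol {n : ℕ} (l : Fin n → ℕ) (t : Fin n → ℝ) (ξ : EuclideanSpace ℝ (Fin n)) : ℝ :=
  ∑ k, t k * |2 * Real.pi * ξ k| ^ (2 * l k)

section Symbol

variable {n : ℕ} {l : Fin n → ℕ} {t : Fin n → ℝ}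

lemma principalSymbol_nonneg (ht : ∀ k, 0 < t k) (ξ : EuclideanSpace ℝ (Fin n)) :
    0 ≤ principalSymbol l t ξ :=
  Finset.sum_nonneg fun k _ => mul_nonneg (ht k).le (by positivity)

lemma le_principalSymbol (ht : ∀ k, 0 < t k) (ξ : EuclideanSpace ℝ (Fin n)) (k : Fin n) :
    t k * |2 * Real.pi * ξ k| ^ (2 * l k) ≤ principalSymbol l t ξ :=
  Finset.single_le_sum (f := fun k => t k * |2 * Real.pi * ξ k| ^ (2 * l k))
    (fun k _ => mul_nonneg (ht k).le (by positivity)) (Finset.mem_univ k)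

lemma pure_symbol_le (hl : ∀ k, 0 < l k) (ht : ∀ k, 0 < t k) (ξ : EuclideanSpace ℝ (Fin n))
    {ρ : ℝ} (hρ : 0 < ρ) (k : Fin n) {i : ℕ} (hi : i ≤ 2 * l k) :
    t k ^ ((i : ℝ) / (2 * l k)) * ρ ^ (1 - (i : ℝ) / (2 * l k)) * |2 * Real.pi * ξ k| ^ i ≤
      principalSymbol l t ξ + ρ := by
  have hp := principalSymbol_nonneg (l := l) ht ξ
  have hlk : (0 : ℝ) < 2 * l k := by
    have := hl k
    positivity
  have hi' : (i : ℝ) / (2 * l k) ≤ 1 := (div_le_one hlk).2 (by exact_mod_cast hi)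
  calc _ = (t k * |2 * Real.pi * ξ k| ^ (2 * l k)) ^ ((i : ℝ) / (2 * l k)) *
        ρ ^ (1 - (i : ℝ) / (2 * l k)) := by
        rw [← rpow_div_mul_abs_pow (ht k) _ (hl k)]
        ring
    _ ≤ (principalSymbol l t ξ + ρ) ^ ((i : ℝ) / (2 * l k)) *
        (principalSymbol l t ξ + ρ) ^ (1 - (i : ℝ) / (2 * l k)) := by
        have h0 := (ht k).le
        have h1 := le_principalSymbol (l := l) ht ξ k
        refine mul_le_mul (Real.rpow_le_rpow (by positivity) (by linarith) (by positivity))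
          (Real.rpow_le_rpow hρ.le (by linarith) (by linarith)) (by positivity) (by positivity)
    _ = principalSymbol l t ξ + ρ := by
        rw [← Real.rpow_add (by positivity)]
        simp

lemma mixed_symbol_le (hl : ∀ k, 0 < l k) (ht : ∀ k, 0 < t k) (ξ : EuclideanSpace ℝ (Fin n))
    {ρ μ : ℝ} (hρ : 0 < ρ) (hμ : 0 ≤ μ) (α : ∀ k : Fin n, Fin (2 * l k + 1)) :
    (∏ k, t k ^ (((α k : ℕ) : ℝ) / (2 * (l k : ℝ)))) * ρ ^ μ *
        ∏ k, |2 * Real.pi * ξ k| ^ (α k : ℕ) ≤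
      (principalSymbol l t ξ + ρ) ^ (nuOrd n l α + μ) := by
  have hp := principalSymbol_nonneg (l := l) ht ξ
  have hR : 0 < principalSymbol l t ξ + ρ := by positivity
  rw [Real.rpow_add hR, nuOrd, Real.rpow_sum_of_pos hR, mul_right_comm, ← Finset.prod_mul_distrib]
  refine mul_le_mul (Finset.prod_le_prod (fun k _ => ?_) fun k _ => ?_)
    (Real.rpow_le_rpow hρ.le (by linarith) hμ) (by positivity)
    (Finset.prod_nonneg fun k _ => by positivity)
  · have := (ht k).le
    positivity
  · rw [rpow_div_mul_abs_pow (ht k) _ (hl k)]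
    have h0 := (ht k).le
    have h1 := le_principalSymbol (l := l) ht ξ k
    exact Real.rpow_le_rpow (by positivity) (by linarith) (by positivity)

end Symbol

/-- The principal part `∑ k, (-1) ^ l k t k ∂ₖ ^ (2 l k) u + A u + z u` as a Schwartz function. -/
def principalPart {n : ℕ} {H : Type*} [NormedAddCommGroup H] [InnerProductSpace ℂ H]
    (A : H →L[ℂ] H) (l : Fin n → ℕ) (z : ℂ) (t : Fin n → ℝ) (u : SchwartzMap (Fin n → ℝ) H) :
    SchwartzMap (Fin n → ℝ) H :=
  (∑ k, (((-1 : ℝ) ^ l k * t k : ℝ) : ℂ) • pdIter n k (2 * l k) u) + u.postcompCLM A + z • u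

section PrincipalPart

variable {n : ℕ} {H : Type*} [NormedAddCommGroup H] [InnerProductSpace ℂ H]
  (A : H →L[ℂ] H) (l : Fin n → ℕ) (z : ℂ) (t : Fin n → ℝ) (u : SchwartzMap (Fin n → ℝ) H)

lemma principalPart_apply (x : Fin n → ℝ) :
    principalPart A l z t u x =
      (∑ k, ((-1 : ℝ) ^ (l k) * t k) • pdIter n k (2 * l k) u x) + A (u x) + z • u x := by
  simp only [principalPart, add_apply, smul_apply, sum_apply, SchwartzMap.postcompCLM_apply,
    Complex.coe_smul]

lemma piFourier_principalPart [CompleteSpace H] (ξ : EuclideanSpace ℝ (Fin n)) :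
    piFourier n H (principalPart A l z t u) ξ =
      (principalSymbol l t ξ : ℂ) • piFourier n H u ξ + A (piFourier n H u ξ) +
        z • piFourier n H u ξ := by
  simp only [principalPart, map_add, map_sum, map_smul, add_apply, smul_apply, sum_apply,
    piFourier_postcompCLM, piFourier_pdIter, principalSymbol, Complex.ofReal_sum, Finset.sum_smul]
  congr 2
  refine Finset.sum_congr rfl fun k _ => ?_
  rw [smul_smul]
  congr 1
  rw [Complex.ofReal_mul (t k), ← neg_one_pow_mul_two_pi_I_mul_pow]
  push_cast
  ring

end PrincipalPart

lemma exists_sum_rpow_neg_le {ι : Type*} (s : Finset ι) {μ : ι → ℝ} (hμ : ∀ j ∈ s, 0 < μ j)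
    (b : ℝ) {ε : ℝ} (hε : 0 < ε) :
    ∃ R : ℝ, 0 < R ∧ ∀ ρ, R ≤ ρ → ∑ j ∈ s, b * ρ ^ (-μ j) ≤ ε := by
  have h : Filter.Tendsto (fun ρ : ℝ => ∑ j ∈ s, b * ρ ^ (-μ j)) Filter.atTop (nhds 0) := by
    have := tendsto_finsetSum s fun j hj =>
      (tendsto_rpow_neg_atTop (hμ j hj)).const_mul b
    simpa using this
  obtain ⟨R, hR⟩ := Filter.eventually_atTop.1 (h.eventually_le_const hε)
  exact ⟨max R 1, by positivity, fun ρ hρ => hR ρ ((le_max_left _ _).trans hρ)⟩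

/-- A Schwartz function dominated by `f` and finitely many Schwartz functions whose total norm
is at most half of its own. -/
lemma L2N_le_two_mul {n : ℕ} {H : Type*} [NormedAddCommGroup H] [InnerProductSpace ℂ H]
    {ι : Type*} (s : Finset ι) {f g : SchwartzMap (Fin n → ℝ) H}
    {v : ι → SchwartzMap (Fin n → ℝ) H} {a : ι → ℝ} (ha : ∀ j ∈ s, 0 ≤ a j)
    (h : ∀ x, ‖g x‖ ≤ ‖f x‖ + ∑ j ∈ s, a j * ‖v j x‖)
    (hhalf : ∑ j ∈ s, a j * L2N n (v j) ≤ 1 / 2 * L2N n g) :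
    L2N n g ≤ 2 * L2N n f := by
  let w : Option ι → (Fin n → ℝ) → H := fun j => j.elim f fun j x => a j • v j x
  have hw : ∀ j ∈ s.insertNone, MemLp (w j) 2 := by
    rintro (_ | j) _
    · exact f.memLp 2
    · exact ((v j).memLp 2).const_smul (a j)
  have hsum := L2N_le_sum (f := g) s.insertNone (g.memLp 2) hw fun x => by
    rw [Finset.sum_insertNone]
    refine (h x).trans_eq (congrArg _ (Finset.sum_congr rfl fun j hj => ?_))
    simp [w, norm_smul, abs_of_nonneg (ha j hj)]
  rw [Finset.sum_insertNone, Finset.sum_congr rfl (g := fun j => a j * L2N n (v j))] at hsum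
  · change L2N n g ≤ L2N n f + _ at hsum
    linarith
  · intro j hj
    exact (L2N_const_smul (a j) (v j)).trans (by rw [abs_of_nonneg (ha j hj)])

section Estimates

variable {n : ℕ} {H : Type*} [NormedAddCommGroup H] [InnerProductSpace ℂ H] [CompleteSpace H]
  {A : H →L[ℂ] H} {l : Fin n → ℕ} {t : Fin n → ℝ} {z : ℂ} {K : ℝ}
  {u g : SchwartzMap (Fin n → ℝ) H}

lemma L2N_pdIter_le (hl : ∀ k, 0 < l k) (ht : ∀ k, 0 < t k) (hz0 : 0 < ‖z‖) (hK : 0 < K)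
    (hres : ∀ ξ : EuclideanSpace ℝ (Fin n),
      (principalSymbol l t ξ + ‖z‖) ^ 2 * ‖piFourier n H u ξ‖ ^ 2 + ‖A (piFourier n H u ξ)‖ ^ 2 ≤
        (K * ‖piFourier n H g ξ‖) ^ 2)
    (k : Fin n) {i : ℕ} (hi : i ∈ Finset.range (2 * l k + 1)) :
    t k ^ ((i : ℝ) / (2 * l k)) * ‖z‖ ^ (1 - (i : ℝ) / (2 * l k)) *
      L2N n (fun x => pdIter n k i u x) ≤ K * L2N n g := by
  have htk := (ht k).le
  refine L2N_le_of_piFourier_le (v := pdIter n k i u) (by positivity) hK.le fun ξ => ?_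
  refine le_trans ?_ (abs_le_of_sq_le_sq' ((le_add_of_nonneg_right (sq_nonneg _)).trans
    (mul_pow _ ‖piFourier n H u ξ‖ 2 ▸ hres ξ)) (by positivity)).2
  rw [piFourier_pdIter, norm_smul, norm_pow, norm_two_pi_I_mul, ← mul_assoc]
  gcongr
  exact pure_symbol_le hl ht ξ hz0 k (Nat.lt_succ_iff.1 (Finset.mem_range.1 hi))

lemma L2N_postcomp_le (hK : 0 < K)
    (hres : ∀ ξ : EuclideanSpace ℝ (Fin n),
      (principalSymbol l t ξ + ‖z‖) ^ 2 * ‖piFourier n H u ξ‖ ^ 2 + ‖A (piFourier n H u ξ)‖ ^ 2 ≤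
        (K * ‖piFourier n H g ξ‖) ^ 2) :
    L2N n (fun x => A (u x)) ≤ K * L2N n g := by
  have := L2N_le_of_piFourier_le (v := u.postcompCLM A) (g := g) zero_le_one hK.le fun ξ => by
    rw [one_mul, piFourier_postcompCLM]
    exact (abs_le_of_sq_le_sq' ((le_add_of_nonneg_left (by positivity)).trans (hres ξ))
      (by positivity)).2
  simpa only [one_mul] using! this

lemma L2N_fracPow_Dmix_le (hA : IsSelfAdjoint A) (hpos : ∀ s ∈ spectrum ℝ A, 0 < s)
    (hl : ∀ k, 0 < l k) (ht : ∀ k, 0 < t k) (hz0 : 0 < ‖z‖) (hK : 0 < K)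
    (hres : ∀ ξ : EuclideanSpace ℝ (Fin n),
      (principalSymbol l t ξ + ‖z‖) ^ 2 * ‖piFourier n H u ξ‖ ^ 2 + ‖A (piFourier n H u ξ)‖ ^ 2 ≤
        (K * ‖piFourier n H g ξ‖) ^ 2)
    (α : ∀ k : Fin n, Fin (2 * l k + 1)) {μ : ℝ} (hμ0 : 0 < μ) (hμ1 : μ < 1 - nuOrd n l α) :
    (∏ k, t k ^ (((α k : ℕ) : ℝ) / (2 * (l k : ℝ)))) *
      L2N n ((Dmix n (fun k => (α k : ℕ)) u).postcompCLM
        (fracPow A (1 - nuOrd n l α - μ))) ≤ K * ‖z‖ ^ (-μ) * L2N n g := by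
  have hτ : 0 ≤ ∏ k, t k ^ (((α k : ℕ) : ℝ) / (2 * (l k : ℝ))) :=
    Finset.prod_nonneg fun k _ => Real.rpow_nonneg (ht k).le _
  have hν : 0 ≤ nuOrd n l α := Finset.sum_nonneg fun k _ => by positivity
  have h := L2N_le_of_piFourier_le (g := g) (K := K)
    (v := (Dmix n (fun k => (α k : ℕ)) u).postcompCLM (fracPow A (1 - nuOrd n l α - μ)))
    (r := (∏ k, t k ^ (((α k : ℕ) : ℝ) / (2 * (l k : ℝ)))) * ‖z‖ ^ μ)
    (by positivity) hK.le fun ξ => by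
      have hp := principalSymbol_nonneg (l := l) ht ξ
      refine le_trans ?_ (abs_le_of_sq_le_sq' ((norm_fracPow_sq_le hA hpos
        (r := principalSymbol l t ξ + ‖z‖) (θ := 1 - nuOrd n l α - μ) (by positivity)
        (by linarith) (by linarith) _).trans (hres ξ)) (by positivity)).2
      rw [piFourier_postcompCLM, piFourier_Dmix, map_smul, norm_smul, norm_prod, ← mul_assoc]
      simp only [norm_pow, norm_two_pi_I_mul]
      gcongr
      refine (mixed_symbol_le hl ht ξ hz0 hμ0.le α).trans_eq ?_
      congr 1
      ring
  rw [Real.rpow_neg hz0.le, mul_right_comm, ← div_eq_mul_inv, le_div_iff₀ (by positivity)]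
  linarith

lemma norm_apply_le_of_norm_comp_fracPow_le (hA : IsSelfAdjoint A)
    (hpos : ∀ s ∈ spectrum ℝ A, 0 < s) {B : H →L[ℂ] H} {θ M : ℝ}
    (hB : ‖B ∘L fracPow A (-θ)‖ ≤ M) (w : H) : ‖B w‖ ≤ M * ‖fracPow A θ w‖ := by
  have hinv : B w = (B ∘L fracPow A (-θ)) (fracPow A θ w) := by
    have h := DFunLike.congr_fun (fracPow_neg_comp_fracPow hA hpos θ) w
    simp only [ContinuousLinearMap.comp_apply, one_apply_eq_self] at h ⊢
    rw [h]
  rw [hinv]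
  exact ContinuousLinearMap.le_of_opNorm_le _ hB _

end Estimates

/-- The coercive estimate (5.13) of Theorem 5.2 (elliptic equation with lower-order
operator coefficients) in the Hilbert-space case with `p = 2` and weight `γ ≡ 1`. -/
theorem coercive_estimate_lower_order_hilbert {H : Type*} [NormedAddCommGroup H]
    [InnerProductSpace ℂ H] [CompleteSpace H] (A : H →L[ℂ] H) (hA : IsSelfAdjoint A)
    (c : ℝ) (hc : 0 < c) (hcoer : ∀ u : H, c * ‖u‖ ^ 2 ≤ (inner ℂ (A u) u : ℂ).re)
    (n : ℕ) (l : Fin n → ℕ) (hl : ∀ k, 0 < l k)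
    (φ : ℝ) (hφ0 : 0 ≤ φ) (hφπ : φ < Real.pi)
    (μα : (∀ k : Fin n, Fin (2 * l k + 1)) → ℝ)
    (Aop : (∀ k : Fin n, Fin (2 * l k + 1)) → (Fin n → ℝ) → (H →L[ℂ] H))
    (M : ℝ)
    (hμα : ∀ α, nuOrd n l α < 1 → 0 < μα α ∧ μα α < 1 - nuOrd n l α)
    (hAop : ∀ α, nuOrd n l α < 1 →
      ∀ x : Fin n → ℝ, ‖Aop α x ∘L fracPow A (-(1 - nuOrd n l α - μα α))‖ ≤ M) :
    ∃ lam0 : ℝ, 0 ≤ lam0 ∧ ∃ C : ℝ, 0 < C ∧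
      ∀ z : ℂ, z ∈ Sector φ → lam0 ≤ ‖z‖ →
      ∀ t : Fin n → ℝ, (∀ k, 0 < t k) → ∀ u f : SchwartzMap (Fin n → ℝ) H,
      (∀ x, (∑ k, ((-1 : ℝ) ^ (l k) * t k) • pdIter n k (2 * l k) u x) + A (u x) + z • u x +
          (∑ α ∈ Finset.univ.filter (fun α => nuOrd n l α < 1),
            (∏ k, t k ^ (((α k : ℕ) : ℝ) / (2 * (l k : ℝ)))) •
              Aop α x (Dmix n (fun k => (α k : ℕ)) u x)) = f x) →
      (∑ k, ∑ i ∈ Finset.range (2 * l k + 1),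
          t k ^ ((i : ℝ) / (2 * l k)) * ‖z‖ ^ (1 - (i : ℝ) / (2 * l k)) *
            L2N n (fun x => pdIter n k i u x)) +
        L2N n (fun x => A (u x))
      ≤ C * L2N n (fun x => f x) := by
  have hpos : ∀ s ∈ spectrum ℝ A, 0 < s := fun s hs =>
    hc.trans_le (le_of_mem_spectrum_of_coercive hA hcoer hs)
  obtain ⟨K, hK, hres⟩ := exists_resolvent_bound (A := A)
    (fun u => le_trans (by positivity) (hcoer u))
    (fun u => (ContinuousLinearMap.isSelfAdjoint_iff_isSymmetric.1 hA).im_inner_apply_self u)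
    hφ0 hφπ
  set s := Finset.univ.filter (fun α : ∀ k : Fin n, Fin (2 * l k + 1) => nuOrd n l α < 1) with hs
  have hmem {α : ∀ k : Fin n, Fin (2 * l k + 1)} : α ∈ s ↔ nuOrd n l α < 1 := by simp [hs]
  obtain ⟨R, hR, hsmall⟩ := exists_sum_rpow_neg_le s (fun α hα => (hμα α (hmem.1 hα)).1)
    (M * K) one_half_pos
  have hsumK : 0 ≤ ∑ k, ∑ _i ∈ Finset.range (2 * l k + 1), K :=
    Finset.sum_nonneg fun _ _ => Finset.sum_nonneg fun _ _ => hK.le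
  refine ⟨R, hR.le, 2 * ((∑ k, ∑ _i ∈ Finset.range (2 * l k + 1), K) + K),
    mul_pos two_pos (by linarith), fun z hz hzR t ht u f heq => ?_⟩
  have hz0 : 0 < ‖z‖ := hR.trans_le hzR
  set g := principalPart A l z t u with hg
  have hresF (ξ : EuclideanSpace ℝ (Fin n)) :
      (principalSymbol l t ξ + ‖z‖) ^ 2 * ‖piFourier n H u ξ‖ ^ 2 + ‖A (piFourier n H u ξ)‖ ^ 2 ≤
        (K * ‖piFourier n H g ξ‖) ^ 2 := by
    rw [hg, piFourier_principalPart]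
    exact hres z hz _ (principalSymbol_nonneg ht ξ) _
  have hτ (α : ∀ k : Fin n, Fin (2 * l k + 1)) :
      0 ≤ ∏ k, t k ^ (((α k : ℕ) : ℝ) / (2 * (l k : ℝ))) :=
    Finset.prod_nonneg fun k _ => Real.rpow_nonneg (ht k).le _
  have hM {α : ∀ k : Fin n, Fin (2 * l k + 1)} (hα : α ∈ s) : 0 ≤ M :=
    (norm_nonneg _).trans (hAop α (hmem.1 hα) 0)
  have hg2 : L2N n g ≤ 2 * L2N n f := by
    refine L2N_le_two_mul s
      (v := fun α => (Dmix n (fun k => (α k : ℕ)) u).postcompCLM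
        (fracPow A (1 - nuOrd n l α - μα α)))
      (a := fun α => M * ∏ k, t k ^ (((α k : ℕ) : ℝ) / (2 * (l k : ℝ))))
      (fun α hα => mul_nonneg (hM hα) (hτ α)) (fun x => ?_) ?_
    · have hx : g x = f x - ∑ α ∈ s, (∏ k, t k ^ (((α k : ℕ) : ℝ) / (2 * (l k : ℝ)))) •
          Aop α x (Dmix n (fun k => (α k : ℕ)) u x) := by
        rw [eq_sub_iff_add_eq, hg, principalPart_apply]
        exact heq x
      rw [hx]
      refine (norm_sub_le _ _).trans (add_le_add le_rfl ((norm_sum_le _ _).trans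
        (Finset.sum_le_sum fun α hα => ?_)))
      rw [norm_smul, Real.norm_of_nonneg (hτ α), mul_comm M, mul_assoc]
      exact mul_le_mul_of_nonneg_left
        (norm_apply_le_of_norm_comp_fracPow_le hA hpos (hAop α (hmem.1 hα) x) _) (hτ α)
    · refine le_trans ?_ (mul_le_mul_of_nonneg_right (hsmall ‖z‖ hzR) (L2N_nonneg _))
      rw [Finset.sum_mul]
      refine Finset.sum_le_sum fun α hα => ?_
      obtain ⟨hμ0, hμ1⟩ := hμα α (hmem.1 hα)
      have h := mul_le_mul_of_nonneg_left
        (L2N_fracPow_Dmix_le hA hpos hl ht hz0 hK hresF α hμ0 hμ1) (hM hα)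
      simpa only [mul_assoc] using h
  calc _ ≤ (∑ k, ∑ _i ∈ Finset.range (2 * l k + 1), K * L2N n g) + K * L2N n g :=
        add_le_add (Finset.sum_le_sum fun k _ => Finset.sum_le_sum fun i hi =>
          L2N_pdIter_le hl ht hz0 hK hresF k hi) (L2N_postcomp_le hK hresF)
    _ = ((∑ k, ∑ _i ∈ Finset.range (2 * l k + 1), K) + K) * L2N n g := by
        simp only [← Finset.sum_mul, add_mul]
    _ ≤ ((∑ k, ∑ _i ∈ Finset.range (2 * l k + 1), K) + K) * (2 * L2N n f) :=
        mul_le_mul_of_nonneg_left hg2 (by linarith)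
    _ = _ := by ring
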